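/- arXiv:1408.5591 — 2 statements merged into one kernel-verified Lean document; each statement's English description precedes it below -/
import Mathlib

section
/- For every real γ with 0 < γ < 1: g_0^{(1−γ)} = (2−γ)/2, g_1^{(1−γ)} = (−γ² + 4γ − 2)/2, and g_ℓ^{(1−γ)} < 0 for every integer ℓ ≥ 2. -/
/-- Generalized binomial coefficient `C(μ,ℓ) = μ(μ−1)⋯(μ−ℓ+1)/ℓ!`. -/
noncomputable def genBinom (μ : ℝ) (ℓ : ℕ) : ℝ :=
  (∏ i ∈ Finset.range ℓ, (μ - i)) / (Nat.factorial ℓ : ℝ)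

/-- Grünwald–Letnikov coefficient `ϖ_ℓ^{(μ)} = (−1)^ℓ · C(μ,ℓ)`. -/
noncomputable def varpi (μ : ℝ) (ℓ : ℕ) : ℝ :=
  (-1 : ℝ) ^ ℓ * genBinom μ ℓ

/-- The coefficients `g_ℓ^{(1−γ)}`. -/
noncomputable def gcoef (γ : ℝ) : ℕ → ℝ
  | 0 => ((2 - γ) / 2) * varpi (1 - γ) 0
  | (ℓ + 1) => ((2 - γ) / 2) * varpi (1 - γ) (ℓ + 1) + (γ / 2) * varpi (1 - γ) ℓ

theorem varpi_zero (μ : ℝ) : varpi μ 0 = 1 := by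
  simp [varpi, genBinom]

theorem varpi_succ (μ : ℝ) (ℓ : ℕ) :
    varpi μ (ℓ + 1) = varpi μ ℓ * ((ℓ - μ) / (ℓ + 1)) := by
  have h1 : (ℓ : ℝ) + 1 ≠ 0 := by positivity
  have h2 : (Nat.factorial ℓ : ℝ) ≠ 0 := by positivity
  simp only [varpi, genBinom, Finset.prod_range_succ, Nat.factorial_succ, pow_succ]
  push_cast
  field_simp
  ring

theorem varpi_succ_neg {μ : ℝ} (h0 : 0 < μ) (h1 : μ < 1) (ℓ : ℕ) :
    varpi μ (ℓ + 1) < 0 := by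
  induction ℓ with
  | zero => simpa [varpi_succ, varpi_zero] using h0
  | succ k ih =>
    rw [varpi_succ]
    refine mul_neg_of_neg_of_pos ih (div_pos ?_ (by positivity))
    push_cast
    linarith [Nat.cast_nonneg (α := ℝ) k]

/-- Lemma 5(i): values and signs of the coefficients `g_ℓ^{(1−γ)}`. -/
theorem stmt7 (γ : ℝ) (hγ0 : 0 < γ) (hγ1 : γ < 1) :
    gcoef γ 0 = (2 - γ) / 2 ∧
      gcoef γ 1 = (-γ ^ 2 + 4 * γ - 2) / 2 ∧
      ∀ ℓ : ℕ, 2 ≤ ℓ → gcoef γ ℓ < 0 := by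
  refine ⟨by simp [gcoef, varpi_zero], ?_, ?_⟩
  · simp only [gcoef, varpi_succ, varpi_zero]
    push_cast
    ring
  · intro ℓ hℓ
    obtain ⟨k, rfl⟩ := Nat.exists_eq_add_of_le' hℓ
    have hneg := varpi_succ_neg (sub_pos.2 hγ1) (sub_lt_self 1 hγ0)
    exact add_neg (mul_neg_of_pos_of_neg (by linarith) (hneg (k + 1)))
      (mul_neg_of_pos_of_neg (by linarith) (hneg k))
end

section
/- For every s ∈ [0,1], one has |P̃(s)| ≤ Q̃(s); in particular Q̃(s) > 0 and |P̃(s)/Q̃(s)| ≤ 1. -/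
/-- `G_ℓ = μ_α·g_ℓ^{(1−α)} + μ_β·g_ℓ^{(1−β)}`. -/
noncomputable def Gc (μa μb α β : ℝ) (ℓ : ℕ) : ℝ :=
  μa * gcoef α ℓ + μb * gcoef β ℓ

/-- `Q(s)` of the sixth-order compact scheme. -/
noncomputable def Qfun (μa μb α β s : ℝ) : ℝ :=
  (1 - (8 / 45) * s ^ 2) + 4 * Gc μa μb α β 0 * s * (1 + s / 3)

/-- `P(s)` of the sixth-order compact scheme. -/
noncomputable def Pfun (μa μb α β s : ℝ) : ℝ :=
  (1 - (8 / 45) * s ^ 2) - 4 * Gc μa μb α β 1 * s * (1 + s / 3)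

/-- `Q̃(s)` of the eighth-order compact scheme. -/
noncomputable def Qtfun (μa μb α β s : ℝ) : ℝ :=
  (1 - (4 / 35) * s ^ 3) + 4 * Gc μa μb α β 0 * s * (1 + s / 3 + (8 / 45) * s ^ 2)

/-- `P̃(s)` of the eighth-order compact scheme. -/
noncomputable def Ptfun (μa μb α β s : ℝ) : ℝ :=
  (1 - (4 / 35) * s ^ 3) - 4 * Gc μa μb α β 1 * s * (1 + s / 3 + (8 / 45) * s ^ 2)

theorem gcoef_zero (γ : ℝ) : gcoef γ 0 = (2 - γ) / 2 := by
  simp [gcoef, varpi, genBinom]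

theorem gcoef_one (γ : ℝ) : gcoef γ 1 = (-γ ^ 2 + 4 * γ - 2) / 2 := by
  simp [gcoef, varpi, genBinom]
  ring

theorem abs_gcoef_one_le {γ : ℝ} (h0 : 0 ≤ γ) (h1 : γ ≤ 1) : |gcoef γ 1| ≤ gcoef γ 0 := by
  rw [gcoef_zero, gcoef_one, abs_le]
  constructor <;> nlinarith

theorem abs_Gc_one_le {α β μa μb : ℝ} (hα0 : 0 ≤ α) (hα1 : α ≤ 1) (hβ0 : 0 ≤ β) (hβ1 : β ≤ 1)
    (hμa : 0 ≤ μa) (hμb : 0 ≤ μb) : |Gc μa μb α β 1| ≤ Gc μa μb α β 0 := by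
  unfold Gc
  calc |μa * gcoef α 1 + μb * gcoef β 1|
      ≤ μa * |gcoef α 1| + μb * |gcoef β 1| := by
        simpa [abs_mul, abs_of_nonneg hμa, abs_of_nonneg hμb] using
          abs_add_le (μa * gcoef α 1) (μb * gcoef β 1)
    _ ≤ μa * gcoef α 0 + μb * gcoef β 0 := by
        gcongr
        · exact abs_gcoef_one_le hα0 hα1
        · exact abs_gcoef_one_le hβ0 hβ1

/-- Lemma 8:  `|P̃(s)| ≤ Q̃(s)`, `Q̃(s) > 0` and `|P̃(s)/Q̃(s)| ≤ 1`. -/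
theorem stmt14 (α β μa μb : ℝ) (hα0 : 0 < α) (hα1 : α < 1) (hβ0 : 0 < β) (hβ1 : β < 1)
    (hμa : 0 < μa) (hμb : 0 < μb) :
    ∀ s ∈ Set.Icc (0 : ℝ) 1,
      |Ptfun μa μb α β s| ≤ Qtfun μa μb α β s ∧
        0 < Qtfun μa μb α β s ∧
        |Ptfun μa μb α β s / Qtfun μa μb α β s| ≤ 1 := by
  rintro s ⟨hs0, hs1⟩
  have hG := abs_Gc_one_le hα0.le hα1.le hβ0.le hβ1.le hμa.le hμb.le
  have hG0 : 0 ≤ Gc μa μb α β 0 := (abs_nonneg _).trans hG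
  have hs3 : s ^ 3 ≤ 1 := pow_le_one₀ hs0 hs1
  have hX : 0 ≤ s * (1 + s / 3 + (8 / 45) * s ^ 2) := by positivity
  obtain ⟨hl, hu⟩ := abs_le.mp hG
  have hQ : 0 < Qtfun μa μb α β s := by
    unfold Qtfun
    nlinarith [mul_nonneg hG0 hX]
  have hPQ : |Ptfun μa μb α β s| ≤ Qtfun μa μb α β s := by
    unfold Ptfun Qtfun
    rw [abs_le]
    constructor <;>
      nlinarith [mul_le_mul_of_nonneg_right hl hX, mul_le_mul_of_nonneg_right hu hX]
  refine ⟨hPQ, hQ, ?_⟩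
  rw [abs_div, abs_of_pos hQ]
  exact div_le_one_of_le₀ hPQ hQ.le
end
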